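/- Define G^sH(X,Y) = ⋁_{(φ,φ')} H̃φ(X,Y) ∧ H̃φ'(Y,X), the supremum over all pairs of V-modules φ : X ⇸ Y, φ' : Y ⇸ X with φ' · φ ≤ 1_X^* and φ · φ' ≤ 1_Y^*. Then G^sH is a symmetric V-category structure on isomorphism classes of V-categories: (i) k ≤ G^sH(X,X); (ii) G^sH(X,Y) ⊗ G^sH(Y,Z) ≤ G^sH(X,Z); (iii) G^sH(X,Y) = G^sH(Y,X). Moreover G^sH(X,Y) = ⋁_c (⋀_{x∈X}⋁_{y∈Y} c(x,y)) ∧ (⋀_{y∈Y}⋁_{x∈X} c(y,x)), the join ranging over all V-category structures c on the disjoint union X ⊔ Y whose restrictions to X and to Y are the given structures. -/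

import Mathlib

universe u v

/-- A commutative unital quantale: a complete lattice with a commutative monoid
structure whose multiplication preserves arbitrary suprema in each variable,
and whose unit `k = 1` satisfies `⊥ < 1`. -/
class CommQuantale (V : Type u) extends CompleteLattice V, CommMonoid V where
  mul_sSup : ∀ (a : V) (s : Set V), a * sSup s = ⨆ b ∈ s, a * b
  bot_lt_one : (⊥ : V) < 1

variable {V : Type u} [CommQuantale V]

/-- The internal hom `x ⊸ y` of the quantale, characterized by `z ≤ x ⊸ y ↔ z * x ≤ y`. -/
def qhom (x y : V) : V := sSup {z : V | z * x ≤ y}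

/-- `a : X → X → V` is a `V`-category structure. -/
def IsVCat {X : Type*} (a : X → X → V) : Prop :=
  (∀ x, (1 : V) ≤ a x x) ∧ (∀ x y z, a x y * a y z ≤ a x z)

/-- `f` is a `V`-functor from `(X,a)` to `(Y,b)`. -/
def IsVFun {X Y : Type*} (a : X → X → V) (b : Y → Y → V) (f : X → Y) : Prop :=
  ∀ x y, a x y ≤ b (f x) (f y)

/-- `φ` is a `V`-module from `(X,a)` to `(Y,b)`. -/
def IsVMod {X Y : Type*} (a : X → X → V) (b : Y → Y → V) (φ : X → Y → V) : Prop :=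
  (∀ x' x y, a x' x * φ x y ≤ φ x' y) ∧ (∀ x y y', φ x y * b y y' ≤ φ x y')

/-- The Hausdorff formula: for `φ = a` this is the Hausdorff structure `h_X` on `P X`;
for a `V`-module `φ` it is the lax (Hausdorff) extension `H̃φ`. -/
def hf {X Y : Type*} (φ : X → Y → V) (A : Set X) (B : Set Y) : V :=
  ⨅ x ∈ A, ⨆ y ∈ B, φ x y

/-- Module composition: `mcomp φ ψ` is `ψ · φ` in the paper's notation. -/
def mcomp {X Y Z : Type*} (φ : X → Y → V) (ψ : Y → Z → V) : X → Z → V :=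
  fun x z => ⨆ y, φ x y * ψ y z

/-- The Gromov–Hausdorff "distance": the join of `H̃φ(X,Y)` over all `V`-modules
`φ : X ⇸ Y`. -/
def GH {X Y : Type*} (a : X → X → V) (b : Y → Y → V) : V :=
  ⨆ φ : {φ : X → Y → V // IsVMod a b φ}, hf φ.1 Set.univ Set.univ

/-- The a-priori symmetrized Gromov–Hausdorff structure `G^sH(X,Y)`: the join of
`H̃φ(X,Y) ∧ H̃φ'(Y,X)` over all pairs of V-modules `φ : X ⇸ Y`, `φ' : Y ⇸ X` with
`φ' · φ ≤ 1_X^*` and `φ · φ' ≤ 1_Y^*`. -/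
def GHs {X Y : Type*} (a : X → X → V) (b : Y → Y → V) : V :=
  ⨆ p : {p : (X → Y → V) × (Y → X → V) //
      IsVMod a b p.1 ∧ IsVMod b a p.2 ∧
      (∀ x x', mcomp p.1 p.2 x x' ≤ a x x') ∧
      (∀ y y', mcomp p.2 p.1 y y' ≤ b y y')},
    hf p.1.1 Set.univ Set.univ ⊓ hf p.1.2 Set.univ Set.univ

theorem q_mul_iSup {ι : Sort*} (x : V) (f : ι → V) : x * (⨆ i, f i) = ⨆ i, x * f i := by
  rw [iSup, CommQuantale.mul_sSup, iSup_range]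

theorem q_mul_mono {x y z w : V} (h : x ≤ y) (h' : z ≤ w) : x * z ≤ y * w := by
  have key : ∀ {p q r : V}, q ≤ r → p * q ≤ p * r := by
    intro p q r hqr
    have h1 : r = sSup {q, r} := by simp [sSup_pair, hqr]
    rw [h1, CommQuantale.mul_sSup]
    exact le_iSup₂_of_le q (by simp) le_rfl
  calc x * z ≤ x * w := key h'
    _ = w * x := mul_comm _ _
    _ ≤ w * y := key h
    _ = y * w := mul_comm _ _

theorem q_mul_iSup_le {ι : Sort*} {x z : V} {f : ι → V} (h : ∀ i, x * f i ≤ z) :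
    x * (⨆ i, f i) ≤ z := by
  rw [q_mul_iSup]; exact iSup_le h

theorem q_iSup_mul_le {ι : Sort*} {x z : V} {f : ι → V} (h : ∀ i, f i * x ≤ z) :
    (⨆ i, f i) * x ≤ z := by
  rw [mul_comm]; exact q_mul_iSup_le fun i => by rw [mul_comm]; exact h i

theorem hf_univ {X Y : Type*} (φ : X → Y → V) :
    hf φ Set.univ Set.univ = ⨅ x, ⨆ y, φ x y := by
  simp [hf]

theorem hf_mcomp {X Y Z : Type*} (φ : X → Y → V) (ψ : Y → Z → V) :
    hf φ Set.univ Set.univ * hf ψ Set.univ Set.univ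
      ≤ hf (mcomp φ ψ) Set.univ Set.univ := by
  simp only [hf_univ]
  refine le_iInf fun x => ?_
  refine (q_mul_mono (iInf_le _ x) le_rfl).trans (q_iSup_mul_le fun y => ?_)
  refine (q_mul_mono le_rfl (iInf_le _ y)).trans (q_mul_iSup_le fun z => ?_)
  exact le_iSup_of_le z (le_iSup (fun y => φ x y * ψ y z) y)

theorem mcomp_mod {X Y Z : Type*} {a : X → X → V} {b : Y → Y → V} {c : Z → Z → V}
    {φ : X → Y → V} {ψ : Y → Z → V} (h : IsVMod a b φ) (h' : IsVMod b c ψ) :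
    IsVMod a c (mcomp φ ψ) := by
  constructor
  · intro x' x z
    refine q_mul_iSup_le fun y => le_iSup_of_le y ?_
    rw [← mul_assoc]
    exact q_mul_mono (h.1 _ _ _) le_rfl
  · intro x z z'
    refine q_iSup_mul_le fun y => le_iSup_of_le y ?_
    rw [mul_assoc]
    exact q_mul_mono le_rfl (h'.2 _ _ _)

theorem mcomp_le {X Y Z : Type*} {a : X → X → V} {b : Y → Y → V}
    {φ : X → Y → V} {φ' : Y → X → V} {ψ : Y → Z → V} {ψ' : Z → Y → V}
    (h : IsVMod a b φ)
    (h1 : ∀ x x', mcomp φ φ' x x' ≤ a x x') (h2 : ∀ y y', mcomp ψ ψ' y y' ≤ b y y')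
    (x x' : X) : mcomp (mcomp φ ψ) (mcomp ψ' φ') x x' ≤ a x x' := by
  refine iSup_le fun z => q_iSup_mul_le fun y => q_mul_iSup_le fun y' => ?_
  calc φ x y * ψ y z * (ψ' z y' * φ' y' x')
      = φ x y * (ψ y z * ψ' z y') * φ' y' x' := by simp only [mul_assoc]
    _ ≤ φ x y * b y y' * φ' y' x' :=
        q_mul_mono (q_mul_mono le_rfl
          ((le_iSup (fun z => ψ y z * ψ' z y') z).trans (h2 y y'))) le_rfl
    _ ≤ φ x y' * φ' y' x' := q_mul_mono (h.2 _ _ _) le_rfl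
    _ ≤ a x x' := (le_iSup (fun y => φ x y * φ' y x') y').trans (h1 x x')

theorem le_GHs {X Y : Type*} {a : X → X → V} {b : Y → Y → V}
    {φ : X → Y → V} {φ' : Y → X → V} (h : IsVMod a b φ) (h' : IsVMod b a φ')
    (h1 : ∀ x x', mcomp φ φ' x x' ≤ a x x') (h2 : ∀ y y', mcomp φ' φ y y' ≤ b y y') :
    hf φ Set.univ Set.univ ⊓ hf φ' Set.univ Set.univ ≤ GHs a b := by
  unfold GHs
  exact le_iSup_of_le ⟨(φ, φ'), h, h', h1, h2⟩ le_rfl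

theorem GHs_symm_le {X Y : Type*} (a : X → X → V) (b : Y → Y → V) : GHs a b ≤ GHs b a := by
  refine iSup_le ?_
  rintro ⟨⟨φ, φ'⟩, h, h', h1, h2⟩
  rw [inf_comm]
  exact le_GHs h' h h2 h1

/-- The structure on the disjoint union induced by a pair of modules. -/
def glue {X Y : Type*} (a : X → X → V) (b : Y → Y → V) (φ : X → Y → V) (φ' : Y → X → V) :
    X ⊕ Y → X ⊕ Y → V
  | Sum.inl x, Sum.inl x' => a x x'
  | Sum.inl x, Sum.inr y => φ x y
  | Sum.inr y, Sum.inl x => φ' y x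
  | Sum.inr y, Sum.inr y' => b y y'

/-- `G^sH` is a symmetric V-category structure on isomorphism classes of
V-categories: (i) `k ≤ G^sH(X,X)`; (ii) `G^sH(X,Y) ⊗ G^sH(Y,Z) ≤ G^sH(X,Z)`;
(iii) `G^sH(X,Y) = G^sH(Y,X)`.  Moreover
`G^sH(X,Y) = ⋁_c (⋀_{x∈X}⋁_{y∈Y} c(x,y)) ∧ (⋀_{y∈Y}⋁_{x∈X} c(y,x))`, the join over
all V-category structures `c` on `X ⊔ Y` restricting to the given structures. -/
theorem GHs_structure :
    (∀ (X : Type v) (a : X → X → V), IsVCat a → (1 : V) ≤ GHs a a) ∧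
    (∀ (X Y Z : Type v) (a : X → X → V) (b : Y → Y → V) (c : Z → Z → V),
      IsVCat a → IsVCat b → IsVCat c → GHs a b * GHs b c ≤ GHs a c) ∧
    (∀ (X Y : Type v) (a : X → X → V) (b : Y → Y → V),
      IsVCat a → IsVCat b → GHs a b = GHs b a) ∧
    (∀ (X Y : Type v) (a : X → X → V) (b : Y → Y → V), IsVCat a → IsVCat b →
      GHs a b = ⨆ (c : (X ⊕ Y) → (X ⊕ Y) → V) (_ : IsVCat c)
          (_ : ∀ x x', c (Sum.inl x) (Sum.inl x') = a x x')
          (_ : ∀ y y', c (Sum.inr y) (Sum.inr y') = b y y'),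
          (⨅ x : X, ⨆ y : Y, c (Sum.inl x) (Sum.inr y)) ⊓
          (⨅ y : Y, ⨆ x : X, c (Sum.inr y) (Sum.inl x))) := by
  refine ⟨?_, ?_, ?_, ?_⟩
  · intro X a ha
    have hm : IsVMod a a a := ⟨fun _ _ _ => ha.2 _ _ _, fun _ _ _ => ha.2 _ _ _⟩
    have hc : ∀ x x', mcomp a a x x' ≤ a x x' := fun x x' => iSup_le fun y => ha.2 _ _ _
    refine le_trans ?_ (le_GHs hm hm hc hc)
    rw [inf_idem, hf_univ]
    exact le_iInf fun x => le_iSup_of_le x (ha.1 x)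
  · intro X Y Z a b c _ _ _
    refine q_iSup_mul_le ?_
    rintro ⟨⟨φ, φ'⟩, h, h', h1, h2⟩
    refine q_mul_iSup_le ?_
    rintro ⟨⟨ψ, ψ'⟩, k, k', k1, k2⟩
    refine le_trans (le_inf ?_ ?_) (le_GHs (mcomp_mod h k) (mcomp_mod k' h')
      (mcomp_le h h1 k1) (mcomp_le k' k2 h2))
    · exact (q_mul_mono inf_le_left inf_le_left).trans (hf_mcomp _ _)
    · rw [mul_comm]
      exact (q_mul_mono inf_le_right inf_le_right).trans (hf_mcomp _ _)
  · intro X Y a b _ _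
    exact le_antisymm (GHs_symm_le a b) (GHs_symm_le b a)
  · intro X Y a b ha hb
    apply le_antisymm
    · refine iSup_le ?_
      rintro ⟨⟨φ, φ'⟩, h, h', h1, h2⟩
      have hc : IsVCat (glue a b φ φ') := by
        constructor
        · rintro (x | y)
          · exact ha.1 x
          · exact hb.1 y
        · rintro (x | x) (y | y) (z | z)
          · exact ha.2 _ _ _
          · exact h.1 _ _ _
          · exact (le_iSup (fun y => φ x y * φ' y z) y).trans (h1 x z)
          · exact h.2 _ _ _
          · exact h'.2 _ _ _
          · exact (le_iSup (fun y => φ' x y * φ y z) y).trans (h2 x z)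
          · exact h'.1 _ _ _
          · exact hb.2 _ _ _
      simp only [hf_univ]
      exact le_iSup_of_le (glue a b φ φ') (le_iSup_of_le hc
        (le_iSup_of_le (fun _ _ => rfl) (le_iSup_of_le (fun _ _ => rfl) le_rfl)))
    · refine iSup_le fun c => iSup_le fun hc => iSup_le fun h1 => iSup_le fun h2 => ?_
      have key := le_GHs (a := a) (b := b) (φ := fun x y => c (Sum.inl x) (Sum.inr y))
        (φ' := fun y x => c (Sum.inr y) (Sum.inl x))
        ⟨fun _ _ _ => by rw [← h1]; exact hc.2 _ _ _, fun _ _ _ => by rw [← h2]; exact hc.2 _ _ _⟩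
        ⟨fun _ _ _ => by rw [← h2]; exact hc.2 _ _ _, fun _ _ _ => by rw [← h1]; exact hc.2 _ _ _⟩
        (fun _ _ => by rw [← h1]; exact iSup_le fun _ => hc.2 _ _ _)
        (fun _ _ => by rw [← h2]; exact iSup_le fun _ => hc.2 _ _ _)
      simpa only [hf_univ] using key
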